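/- Let T = (V,E) be a finite rooted tree with n vertices, let 𝓗 be a Polish metric space of diameter at most 1, let b ∈ [0,1), and let ν be a b-Lipschitz 𝓗-valued Markov measure indexed by T. Then for every function f : 𝓗^V → ℝ that is 1-Lipschitz with respect to the normalized Hamming metric and every ε > 0, one has ν{ |f − ∫ f dν| > ε } ≤ 2 e^{−2 n² ε² / Δ²}, where Δ is the ℓ² norm of the descendant generating function of T with parameter b. -/

import Mathlib

open MeasureTheory ProbabilityTheory Filter Topology
open scoped ENNReal NNReal

/-- A rooted tree on vertex type `V`, encoded by its root and parent function:
every vertex reaches the root by iterating `parent`, and the root is a fixed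
point of `parent`. -/
structure ParentTree (V : Type*) where
  root : V
  parent : V → V
  parent_root : parent root = root
  reaches_root : ∀ v : V, ∃ n : ℕ, parent^[n] v = root

namespace ParentTree

variable {V : Type*} (T : ParentTree V)

/-- The depth of a vertex: its graph distance to the root. -/
noncomputable def depth (v : V) : ℕ := sInf {n : ℕ | T.parent^[n] v = T.root}

lemma depth_spec (v : V) : T.parent^[T.depth v] v = T.root :=
  Nat.sInf_mem (T.reaches_root v)

lemma depth_root : T.depth T.root = 0 :=
  Nat.eq_zero_of_le_zero (Nat.sInf_le (by simp))

lemma depth_parent_le (v : V) : T.depth (T.parent v) ≤ T.depth v := by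
  have hspec := T.depth_spec v
  cases h : T.depth v with
  | zero =>
      rw [h] at hspec
      simp only [Function.iterate_zero, id_eq] at hspec
      subst hspec
      simp [T.parent_root, T.depth_root]
  | succ m =>
      rw [h, Function.iterate_succ_apply] at hspec
      exact (Nat.sInf_le hspec).trans (Nat.le_succ m)

/-- `Desc T r v` is the set of descendants of `v` exactly `r` generations below `v`. -/
def Desc (r : ℕ) (v : V) : Set V :=
  {w : V | T.parent^[r] w = v ∧ T.depth w = T.depth v + r}

/-- The set of children of a vertex. -/
def children (v : V) : Set V := {w : V | w ≠ T.root ∧ T.parent w = v}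

/-- The graph distance between two vertices of the tree. -/
noncomputable def tdist (v w : V) : ℕ :=
  sInf {k : ℕ | ∃ n m : ℕ, n + m = k ∧ T.parent^[n] v = T.parent^[m] w}

/-- The descendant generating function `δ(v) = ∑_r |D_r(v)| bʳ`. -/
noncomputable def dgf (b : ℝ) (v : V) : ℝ :=
  ∑' r : ℕ, (Nat.card (T.Desc r v) : ℝ) * b ^ r

/-- `Δ = ‖δ‖_{ℓ²(V)}` for a finite tree. -/
noncomputable def Delta [Fintype V] (b : ℝ) : ℝ :=
  Real.sqrt (∑ v : V, T.dgf b v ^ 2)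

/-- Upper growth rate `limsup_r |D_r(ρ)|^{1/r}`. -/
noncomputable def bargr : ℝ≥0∞ :=
  Filter.atTop.limsup fun r : ℕ => (Nat.card (T.Desc r T.root) : ℝ≥0∞) ^ (1 / (r : ℝ))

/-- Maximum local growth rate `limsup_r max_v |D_r(v)|^{1/r}`. -/
noncomputable def maxgr : ℝ≥0∞ :=
  Filter.atTop.limsup fun r : ℕ => ⨆ v : V, (Nat.card (T.Desc r v) : ℝ≥0∞) ^ (1 / (r : ℝ))

/-- The parent map of the depth-`k` truncation. -/
noncomputable def truncParent (k : ℕ) (v : {v : V // T.depth v ≤ k}) :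
    {v : V // T.depth v ≤ k} :=
  ⟨T.parent v.1, le_trans (T.depth_parent_le v.1) v.2⟩

lemma truncParent_iterate (k n : ℕ) (v : {v : V // T.depth v ≤ k}) :
    ((T.truncParent k)^[n] v).1 = T.parent^[n] v.1 := by
  induction n generalizing v with
  | zero => rfl
  | succ n ih =>
      rw [Function.iterate_succ_apply, Function.iterate_succ_apply]
      exact ih _

/-- The subtree induced by the vertices within distance `k` of the root. -/
noncomputable def trunc (k : ℕ) : ParentTree {v : V // T.depth v ≤ k} where
  root := ⟨T.root, by simp [T.depth_root]⟩
  parent := T.truncParent k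
  parent_root := Subtype.ext T.parent_root
  reaches_root := fun v => by
    obtain ⟨n, hn⟩ := T.reaches_root v.1
    exact ⟨n, Subtype.ext (by rw [truncParent_iterate, hn])⟩

end ParentTree
/-- The transportation cost between two measures relative to a cost function `c`:
the infimum over couplings `γ` of `∫ c dγ`. -/
noncomputable def transportCost {X : Type*} [MeasurableSpace X] (c : X → X → ℝ)
    (μ ν : MeasureTheory.Measure X) : ℝ :=
  sInf {r : ℝ | ∃ γ : MeasureTheory.Measure (X × X),
    γ.map Prod.fst = μ ∧ γ.map Prod.snd = ν ∧ r = ∫ q, c q.1 q.2 ∂γ}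

/-- The normalized Hamming distance on `V → H` induced by the metric of `H`. -/
noncomputable def nhdist {V H : Type*} [Fintype V] [PseudoMetricSpace H] (x y : V → H) : ℝ :=
  (Fintype.card V : ℝ)⁻¹ * ∑ v, dist (x v) (y v)

namespace ParentTree

open Classical in
/-- The broadcast (Markov) measure built up level by level: at step `k+1` all the
coordinates at depth `k+1` are sampled, conditionally independently, from the kernels
applied to the values at their parents. -/
noncomputable def levelMeasure {V : Type*} [Fintype V] (T : ParentTree V)
    {H : Type*} [MeasurableSpace H] (m : MeasureTheory.Measure H)
    (q : V → ProbabilityTheory.Kernel H H) : ℕ → MeasureTheory.Measure (V → H)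
  | 0 => m.map (fun h _ => h)
  | (k+1) => (T.levelMeasure m q k).bind fun x =>
      MeasureTheory.Measure.pi fun v =>
        if T.depth v = k + 1 then (q v) (x (T.parent v)) else MeasureTheory.Measure.dirac (x v)

/-- `ν` is a `b`-Lipschitz `H`-valued Markov measure indexed by `T`: it is the broadcast
model of some root distribution and some Markov kernels, each non-root kernel being
`b`-Lipschitz from `H` to the space of measures with the transportation metric. -/
def IsLipMarkov {V : Type*} [Fintype V] (T : ParentTree V)
    {H : Type*} [MeasurableSpace H] [PseudoMetricSpace H] (b : ℝ)
    (ν : MeasureTheory.Measure (V → H)) : Prop :=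
  ∃ (m : MeasureTheory.Measure H) (q : V → ProbabilityTheory.Kernel H H),
    MeasureTheory.IsProbabilityMeasure m ∧ (∀ v, ProbabilityTheory.IsMarkovKernel (q v)) ∧
    (∀ v, v ≠ T.root → ∀ x y : H, transportCost dist ((q v) x) ((q v) y) ≤ b * dist x y) ∧
    ν = T.levelMeasure m q (Fintype.card V)

end ParentTree

section CoordLipschitz

variable {V H : Type*} [Fintype V] [PseudoMetricSpace H]

/-- `F` is Lipschitz with constant `a v` in each coordinate `v`. -/
def CoordLipschitz (a : V → ℝ) (F : (V → H) → ℝ) : Prop :=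
  ∀ x y : V → H, |F x - F y| ≤ ∑ v, a v * dist (x v) (y v)

namespace CoordLipschitz

variable {a : V → ℝ} {F : (V → H) → ℝ}

lemma continuous (hF : CoordLipschitz a F) : Continuous F := by
  refine continuous_iff_continuousAt.2 fun x => tendsto_iff_dist_tendsto_zero.2 ?_
  refine squeeze_zero (fun _ => dist_nonneg) (fun y => hF y x) ?_
  have : Continuous fun y : V → H => ∑ v, a v * dist (y v) (x v) := by fun_prop
  simpa using this.tendsto x

lemma exists_abs_le (hd : ∀ x y : H, dist x y ≤ 1) (hF : CoordLipschitz a F) :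
    ∃ B : ℝ, ∀ x, |F x| ≤ B := by
  rcases isEmpty_or_nonempty (V → H) with h | ⟨⟨x₀⟩⟩
  · exact ⟨0, fun x => h.elim x⟩
  refine ⟨|F x₀| + ∑ v, |a v|, fun x => ?_⟩
  have h₁ : ∑ v, a v * dist (x v) (x₀ v) ≤ ∑ v, |a v| := Finset.sum_le_sum fun v _ =>
    (mul_le_mul_of_nonneg_right (le_abs_self _) dist_nonneg).trans
      (mul_le_of_le_one_right (abs_nonneg _) (hd _ _))
  have h₂ := abs_sub_abs_le_abs_sub (F x) (F x₀)
  linarith [hF x x₀]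

variable [MeasurableSpace H] [BorelSpace H] [SecondCountableTopology H]

lemma measurable (hF : CoordLipschitz a F) : Measurable F :=
  hF.continuous.measurable

lemma integrable (hd : ∀ x y : H, dist x y ≤ 1) (hF : CoordLipschitz a F)
    (μ : Measure (V → H)) [IsFiniteMeasure μ] : Integrable F μ := by
  obtain ⟨B, hB⟩ := hF.exists_abs_le hd
  exact .of_bound hF.measurable.aestronglyMeasurable B (.of_forall hB)

lemma integrable_exp (hd : ∀ x y : H, dist x y ≤ 1) (hF : CoordLipschitz a F) (t : ℝ)
    (μ : Measure (V → H)) [IsFiniteMeasure μ] : Integrable (fun x => Real.exp (t * F x)) μ := by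
  obtain ⟨B, hB⟩ := hF.exists_abs_le hd
  refine integrable_exp_mul_of_mem_Icc (a := -B) (b := B) hF.measurable.aemeasurable
    (.of_forall fun x => abs_le.1 (hB x))

end CoordLipschitz

/-- **Hoeffding's lemma** for a function of oscillation at most `c`. -/
lemma integral_exp_le_of_abs_sub_le {Ω : Type*} [MeasurableSpace Ω] (μ : Measure Ω)
    [IsProbabilityMeasure μ] {g : Ω → ℝ} (hg : Measurable g) {c : ℝ}
    (hc : ∀ x y, |g x - g y| ≤ c) (t : ℝ) :
    ∫ x, Real.exp (t * g x) ∂μ ≤ Real.exp (t * ∫ x, g x ∂μ + t ^ 2 / 8 * c ^ 2) := by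
  have hne : Nonempty Ω := μ.nonempty_of_neZero
  obtain ⟨x₀⟩ := hne
  have hbdd : BddBelow (Set.range g) :=
    ⟨g x₀ - c, by rintro _ ⟨x, rfl⟩; linarith [(abs_le.1 (hc x₀ x)).2]⟩
  have hmem : ∀ x, g x ∈ Set.Icc (⨅ y, g y) ((⨅ y, g y) + c) := fun x =>
    ⟨ciInf_le hbdd x, by
      have : Nonempty Ω := ⟨x₀⟩
      have : g x - c ≤ ⨅ y, g y := le_ciInf fun y => by linarith [(abs_le.1 (hc x y)).2]
      linarith⟩
  have h := (hasSubgaussianMGF_of_mem_Icc (μ := μ) hg.aemeasurable (.of_forall hmem)).mgf_le t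
  simp only [mgf, mul_sub, Real.exp_sub, integral_div, add_sub_cancel_left] at h
  rw [div_le_iff₀ (Real.exp_pos _), ← Real.exp_add] at h
  refine h.trans_eq (congrArg Real.exp ?_)
  simp only [NNReal.coe_pow, NNReal.coe_div, coe_nnnorm, NNReal.coe_ofNat, Real.norm_eq_abs,
    div_pow, sq_abs]
  ring

end CoordLipschitz

lemma measurable_update_prod {V H : Type*} [MeasurableSpace H] [DecidableEq V] (v : V) :
    Measurable fun p : (V → H) × H => Function.update p.1 v p.2 :=
  measurable_pi_iff.2 fun w => by
    by_cases h : w = v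
    · subst h; simpa using measurable_snd
    · simpa [Function.update_of_ne h, Function.comp_def] using
        (measurable_pi_apply w).comp measurable_fst

section PiMeasure

variable {V H : Type*} [Fintype V] [MeasurableSpace H]

/-- Resampling one coordinate of a product of probability measures. -/
lemma map_update_prod_pi [DecidableEq V] (ν : V → Measure H) [∀ v, IsProbabilityMeasure (ν v)]
    (v : V) (μ : Measure H) [IsProbabilityMeasure μ] :
    ((Measure.pi ν).prod μ).map (fun p => Function.update p.1 v p.2) =
      Measure.pi (Function.update ν v μ) := by
  have : ∀ w, IsProbabilityMeasure (Function.update ν v μ w) := fun w => by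
    by_cases h : w = v
    · subst h; simpa
    · rw [Function.update_of_ne h]; infer_instance
  refine (Measure.pi_eq fun s hs => ?_).symm
  rw [Measure.map_apply (measurable_update_prod v) (.univ_pi hs)]
  have hpre : (fun p : (V → H) × H => Function.update p.1 v p.2) ⁻¹' Set.univ.pi s =
      (Set.univ.pi (Function.update s v Set.univ)) ×ˢ s v := by
    ext ⟨x, h⟩
    simp only [Set.mem_preimage, Set.mem_univ_pi, Set.mem_prod]
    constructor
    · intro hx
      refine ⟨fun w => ?_, by simpa using hx v⟩
      by_cases hw : w = v
      · subst hw; simp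
      · simpa [Function.update_of_ne hw] using hx w
    · rintro ⟨hx, hh⟩ w
      by_cases hw : w = v
      · subst hw; simpa
      · simpa [Function.update_of_ne hw] using hx w
  rw [hpre, Measure.prod_prod, Measure.pi_pi,
    ← Finset.prod_erase_mul _ _ (Finset.mem_univ v),
    ← Finset.prod_erase_mul _ _ (Finset.mem_univ v)]
  simp only [Function.update_self, measure_univ, mul_one]
  congr 1
  refine Finset.prod_congr rfl fun w hw => ?_
  rw [Function.update_of_ne (Finset.ne_of_mem_erase hw),
    Function.update_of_ne (Finset.ne_of_mem_erase hw)]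

lemma integral_pi_update [DecidableEq V] (ν : V → Measure H) [∀ v, IsProbabilityMeasure (ν v)]
    (v : V) (μ : Measure H) [IsProbabilityMeasure μ] {Φ : (V → H) → ℝ}
    (hΦ : Integrable Φ (Measure.pi (Function.update ν v μ))) :
    ∫ x, Φ x ∂Measure.pi (Function.update ν v μ) =
      ∫ y, ∫ h, Φ (Function.update y v h) ∂μ ∂Measure.pi ν := by
  rw [← map_update_prod_pi] at hΦ ⊢
  rw [integral_map (measurable_update_prod v).aemeasurable hΦ.aestronglyMeasurable]
  exact integral_prod _ (hΦ.comp_measurable (measurable_update_prod v))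

lemma integrable_integral_update [DecidableEq V] (ν : V → Measure H)
    [∀ v, IsProbabilityMeasure (ν v)] (v : V) (μ : Measure H) [IsProbabilityMeasure μ]
    {Φ : (V → H) → ℝ} (hΦ : Integrable Φ (Measure.pi (Function.update ν v μ))) :
    Integrable (fun y => ∫ h, Φ (Function.update y v h) ∂μ) (Measure.pi ν) := by
  rw [← map_update_prod_pi] at hΦ
  exact (hΦ.comp_measurable (measurable_update_prod v)).integral_prod_left

lemma pi_dirac (x : V → H) : Measure.pi (fun v => Measure.dirac (x v)) = Measure.dirac x := by
  classical
  refine Measure.pi_eq fun s hs => ?_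
  rw [Measure.dirac_apply' _ (.univ_pi hs)]
  simp only [Measure.dirac_apply' _ (hs _), Set.indicator_apply, Set.mem_univ_pi, Pi.one_apply]
  by_cases h : ∀ v, x v ∈ s v
  · simp [h]
  · rw [if_neg h]
    push Not at h
    obtain ⟨v, hv⟩ := h
    exact (Finset.prod_eq_zero (Finset.mem_univ v) (by simp [hv])).symm

/-- A measurable family of probability measures in each coordinate gives a measurable family of
product measures. -/
lemma measurable_measure_pi {α : Type*} [MeasurableSpace α] {μ : α → V → Measure H}
    [∀ a v, IsProbabilityMeasure (μ a v)] (hμ : ∀ v, Measurable fun a => μ a v) :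
    Measurable fun a => Measure.pi (μ a) := by
  refine .measure_of_isPiSystem_of_isProbabilityMeasure generateFrom_pi.symm isPiSystem_pi ?_
  rintro _ ⟨s, hs, rfl⟩
  simp only [Measure.pi_pi]
  exact Finset.measurable_prod _ fun v _ =>
    (Measure.measurable_coe (hs v (Set.mem_univ v))).comp (hμ v)

end PiMeasure

section PiConcentration

variable {V H : Type*} [Fintype V] [PseudoMetricSpace H] [MeasurableSpace H] [BorelSpace H]
  [SecondCountableTopology H] {a : V → ℝ} {F : (V → H) → ℝ}

lemma CoordLipschitz.integral_update [DecidableEq V] (hd : ∀ x y : H, dist x y ≤ 1)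
    (ha : ∀ v, 0 ≤ a v) (hF : CoordLipschitz a F) (v : V) (μ : Measure H)
    [IsProbabilityMeasure μ] :
    CoordLipschitz a fun y => ∫ h, F (Function.update y v h) ∂μ := by
  have hint : ∀ y, Integrable (fun h => F (Function.update y v h)) μ := fun y => by
    obtain ⟨B, hB⟩ := hF.exists_abs_le hd
    exact .of_bound (hF.measurable.comp (measurable_update y)).aestronglyMeasurable B
      (.of_forall fun h => hB _)
  intro x y
  simp only
  rw [← integral_sub (hint x) (hint y)]
  suffices h : ∀ h, ‖F (Function.update x v h) - F (Function.update y v h)‖ ≤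
      ∑ w, a w * dist (x w) (y w) by
    simpa using norm_integral_le_of_norm_le_const (μ := μ) (.of_forall h)
  intro h
  refine (hF _ _).trans (Finset.sum_le_sum fun w _ => ?_)
  by_cases hw : w = v
  · subst hw
    simpa using mul_nonneg (ha w) dist_nonneg
  · simp [Function.update_of_ne hw]

/-- **McDiarmid's inequality**, exponential moment form, for a product of measures which are
deterministic outside `S`. -/
lemma CoordLipschitz.integral_exp_pi_le (hd : ∀ x y : H, dist x y ≤ 1) (ha : ∀ v, 0 ≤ a v)
    (hF : CoordLipschitz a F) (S : Finset V) (x : V → H) (ν : V → Measure H)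
    [∀ v, IsProbabilityMeasure (ν v)] (hS : ∀ v ∉ S, ν v = Measure.dirac (x v)) (t : ℝ) :
    ∫ y, Real.exp (t * F y) ∂Measure.pi ν ≤
      Real.exp (t * ∫ y, F y ∂Measure.pi ν + t ^ 2 / 8 * ∑ v ∈ S, a v ^ 2) := by
  classical
  induction S using Finset.induction_on generalizing F ν with
  | empty =>
    obtain rfl : ν = fun v => Measure.dirac (x v) := funext fun v => hS v (Finset.notMem_empty v)
    have hm : Measurable fun y => Real.exp (t * F y) := (hF.measurable.const_mul t).exp
    rw [pi_dirac, integral_dirac' _ _ hm.stronglyMeasurable,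
      integral_dirac' _ _ hF.measurable.stronglyMeasurable]
    simp
  | insert v S hv ih =>
    set ν₀ : V → Measure H := Function.update ν v (Measure.dirac (x v)) with hν₀
    have hprob : ∀ w, IsProbabilityMeasure (ν₀ w) := fun w => by
      by_cases h : w = v
      · subst h; simp only [hν₀, Function.update_self]; infer_instance
      · rw [hν₀, Function.update_of_ne h]; infer_instance
    have hν : Function.update ν₀ v (ν v) = ν := by simp [hν₀]
    have hS₀ : ∀ w ∉ S, ν₀ w = Measure.dirac (x w) := fun w hw => by
      by_cases h : w = v
      · subst h; simp [hν₀]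
      · rw [hν₀, Function.update_of_ne h, hS w (by simp [h, hw])]
    have hE : Integrable (fun y => Real.exp (t * F y)) (Measure.pi (Function.update ν₀ v (ν v))) := by
      rw [hν]; exact hF.integrable_exp hd t _
    have hI : Integrable F (Measure.pi (Function.update ν₀ v (ν v))) := by
      rw [hν]; exact hF.integrable hd _
    have hG := hF.integral_update hd ha v (ν v)
    have key := ih hG ν₀ hS₀
    rw [← integral_pi_update ν₀ v (ν v) hI, hν] at key
    calc ∫ y, Real.exp (t * F y) ∂Measure.pi ν
        = ∫ y, ∫ h, Real.exp (t * F (Function.update y v h)) ∂ν v ∂Measure.pi ν₀ := by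
          rw [← integral_pi_update ν₀ v (ν v) hE, hν]
      _ ≤ ∫ y, Real.exp (t * ∫ h, F (Function.update y v h) ∂ν v) *
            Real.exp (t ^ 2 / 8 * a v ^ 2) ∂Measure.pi ν₀ := by
          refine integral_mono (integrable_integral_update ν₀ v (ν v) hE)
            ((hG.integrable_exp hd t _).mul_const _) fun y => ?_
          rw [← Real.exp_add]
          refine integral_exp_le_of_abs_sub_le (ν v) (hF.measurable.comp (measurable_update y))
            (fun h h' => (hF _ _).trans ?_) t
          rw [Finset.sum_eq_single v (fun w _ hw => by simp [Function.update_of_ne hw])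
            (fun h => absurd (Finset.mem_univ v) h)]
          simpa using mul_le_of_le_one_right (ha v) (hd h h')
      _ ≤ Real.exp (t * ∫ y, F y ∂Measure.pi ν + t ^ 2 / 8 * ∑ w ∈ S, a w ^ 2) *
            Real.exp (t ^ 2 / 8 * a v ^ 2) := by
          rw [integral_mul_const]
          exact mul_le_mul_of_nonneg_right key (Real.exp_nonneg _)
      _ = _ := by
          rw [← Real.exp_add, Finset.sum_insert hv]
          ring_nf

/-- Expectations of a coordinatewise Lipschitz function under two product measures, in terms of
the costs of couplings of the marginals. -/
lemma CoordLipschitz.abs_integral_pi_sub_le (hd : ∀ x y : H, dist x y ≤ 1) (ha : ∀ v, 0 ≤ a v)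
    (hF : CoordLipschitz a F) (μ μ' : V → Measure H) [∀ v, IsProbabilityMeasure (μ v)]
    [∀ v, IsProbabilityMeasure (μ' v)] {c : V → ℝ}
    (hc : ∀ v, transportCost dist (μ v) (μ' v) ≤ c v) :
    |∫ x, F x ∂Measure.pi μ - ∫ x, F x ∂Measure.pi μ'| ≤ ∑ v, a v * c v := by
  have hne : ∀ v, {r : ℝ | ∃ γ : Measure (H × H), γ.map Prod.fst = μ v ∧
      γ.map Prod.snd = μ' v ∧ r = ∫ q, dist q.1 q.2 ∂γ}.Nonempty := fun v =>
    ⟨_, (μ v).prod (μ' v), by simp [Measure.map_fst_prod], by simp [Measure.map_snd_prod], rfl⟩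
  have approx : ∀ η : ℝ, 0 < η →
      |∫ x, F x ∂Measure.pi μ - ∫ x, F x ∂Measure.pi μ'| ≤ ∑ v, a v * (c v + η) := by
    intro η hη
    have : ∀ v, ∃ γ : Measure (H × H), γ.map Prod.fst = μ v ∧ γ.map Prod.snd = μ' v ∧
        ∫ q, dist q.1 q.2 ∂γ ≤ c v + η := fun v => by
      obtain ⟨_, ⟨γ, h₁, h₂, rfl⟩, h₃⟩ := exists_lt_of_csInf_lt (hne v)
        (lt_of_le_of_lt (hc v) (lt_add_of_pos_right (c v) hη))
      exact ⟨γ, h₁, h₂, h₃.le⟩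
    choose γ h₁ h₂ h₃ using this
    have hγ : ∀ v, IsProbabilityMeasure (γ v) := fun v => ⟨by
      have := congrArg (fun m => m Set.univ) (h₁ v)
      simpa [Measure.map_apply measurable_fst MeasurableSet.univ] using this⟩
    have hσ₁ : ∀ v, IsProbabilityMeasure ((γ v).map Prod.fst) := fun v => by rw [h₁]; infer_instance
    have hσ₂ : ∀ v, IsProbabilityMeasure ((γ v).map Prod.snd) := fun v => by rw [h₂]; infer_instance
    have e₁ : (Measure.pi γ).map (fun z v => (z v).1) = Measure.pi μ := by
      rw [Measure.pi_map_pi (fun v => measurable_fst.aemeasurable)]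
      simp only [h₁]
    have e₂ : (Measure.pi γ).map (fun z v => (z v).2) = Measure.pi μ' := by
      rw [Measure.pi_map_pi (fun v => measurable_snd.aemeasurable)]
      simp only [h₂]
    have m₁ : Measurable fun (z : V → H × H) v => (z v).1 := by fun_prop
    have m₂ : Measurable fun (z : V → H × H) v => (z v).2 := by fun_prop
    have i₁ := hF.integrable hd (Measure.pi μ)
    have i₂ := hF.integrable hd (Measure.pi μ')
    rw [← e₁] at i₁ ⊢
    rw [← e₂] at i₂ ⊢
    rw [integral_map m₁.aemeasurable i₁.aestronglyMeasurable,
      integral_map m₂.aemeasurable i₂.aestronglyMeasurable]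
    have hdist : ∀ v, Integrable (fun z : V → H × H => dist (z v).1 (z v).2) (Measure.pi γ) :=
      fun v => .of_bound (by fun_prop) 1 (.of_forall fun z => by
        rw [Real.norm_of_nonneg dist_nonneg]; exact hd _ _)
    calc |∫ z, F (fun v => (z v).1) ∂Measure.pi γ - ∫ z, F (fun v => (z v).2) ∂Measure.pi γ|
        = |∫ z, (F (fun v => (z v).1) - F (fun v => (z v).2)) ∂Measure.pi γ| :=
          congrArg abs
            (integral_sub (i₁.comp_measurable m₁) (i₂.comp_measurable m₂)).symm
      _ ≤ ∫ z, |F (fun v => (z v).1) - F (fun v => (z v).2)| ∂Measure.pi γ :=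
          abs_integral_le_integral_abs
      _ ≤ ∫ z, ∑ v, a v * dist (z v).1 (z v).2 ∂Measure.pi γ :=
          integral_mono ((i₁.comp_measurable m₁).sub (i₂.comp_measurable m₂)).abs
            (integrable_finsetSum _ fun v _ => (hdist v).const_mul _) fun z => hF _ _
      _ = ∑ v, a v * ∫ q, dist q.1 q.2 ∂γ v := by
          rw [integral_finsetSum _ fun v _ => (hdist v).const_mul _]
          refine Finset.sum_congr rfl fun v _ => ?_
          rw [integral_const_mul]
          congr 1
          have := measurePreserving_eval γ v
          rw [← this.map_eq, integral_map this.measurable.aemeasurable (by fun_prop)]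
      _ ≤ ∑ v, a v * (c v + η) := Finset.sum_le_sum fun v _ =>
          mul_le_mul_of_nonneg_left (h₃ v) (ha v)
  have hlim : Tendsto (fun η : ℝ => ∑ v, a v * (c v + η)) (𝓝[>] 0) (𝓝 (∑ v, a v * c v)) := by
    have : Continuous fun η : ℝ => ∑ v, a v * (c v + η) := by fun_prop
    simpa using (this.tendsto 0).mono_left nhdsWithin_le_nhds
  exact ge_of_tendsto hlim (eventually_mem_nhdsWithin.mono approx)

end PiConcentration

lemma transportCost_dirac_le {H : Type*} [PseudoMetricSpace H] [MeasurableSpace H] [BorelSpace H]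
    [SecondCountableTopology H] (x y : H) :
    transportCost dist (Measure.dirac x) (Measure.dirac y) ≤ dist x y := by
  refine csInf_le ⟨0, ?_⟩ ⟨Measure.dirac (x, y), ?_, ?_, ?_⟩
  · rintro _ ⟨γ, -, -, rfl⟩
    exact integral_nonneg fun _ => dist_nonneg
  · exact Measure.map_dirac' measurable_fst _
  · exact Measure.map_dirac' measurable_snd _
  · rw [integral_dirac' _ _ (measurable_dist.stronglyMeasurable)]

lemma integral_bind_of_measurable {α β : Type*} [MeasurableSpace α] [MeasurableSpace β]
    {μ : Measure α} {κ : α → Measure β} (hκ : Measurable κ) {g : β → ℝ}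
    (hg : Integrable g (μ.bind κ)) :
    ∫ y, g y ∂μ.bind κ = ∫ x, ∫ y, g y ∂κ x ∂μ := by
  have := Kernel.integral_comp (κ := Kernel.const Unit μ) (η := ⟨κ, hκ⟩) (a := ()) (f := g)
  simp only [Kernel.comp_apply, Kernel.const_apply, Kernel.coe_mk] at this
  exact this hg

lemma integrable_integral_of_bind {α β : Type*} [MeasurableSpace α] [MeasurableSpace β]
    {μ : Measure α} {κ : α → Measure β} (hκ : Measurable κ) {g : β → ℝ}
    (hg : Integrable g (μ.bind κ)) :
    Integrable (fun x => ∫ y, g y ∂κ x) μ := by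
  have := Integrable.integral_comp (κ := Kernel.const Unit μ) (η := ⟨κ, hκ⟩) (a := ()) (f := g)
  simp only [Kernel.comp_apply, Kernel.const_apply, Kernel.coe_mk] at this
  exact this hg

namespace ParentTree

section Depth

variable {V : Type*} (T : ParentTree V)

lemma depth_le_depth_parent_add_one (v : V) : T.depth v ≤ T.depth (T.parent v) + 1 :=
  Nat.sInf_le (by
    rw [Set.mem_ofPred_eq, Function.iterate_succ_apply]
    exact T.depth_spec (T.parent v))

lemma depth_parent_of_depth_eq_succ {v : V} {k : ℕ} (h : T.depth v = k + 1) :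
    T.depth (T.parent v) = k := by
  refine le_antisymm (Nat.sInf_le ?_) (by have := T.depth_le_depth_parent_add_one v; omega)
  rw [Set.mem_ofPred_eq, ← Function.iterate_succ_apply, Nat.succ_eq_add_one, ← h]
  exact T.depth_spec v

lemma eq_root_of_depth_eq_zero {v : V} (h : T.depth v = 0) : v = T.root := by
  simpa [h] using T.depth_spec v

lemma ne_root_of_depth_eq_succ {v : V} {k : ℕ} (h : T.depth v = k + 1) : v ≠ T.root := by
  rintro rfl
  rw [T.depth_root] at h
  omega

lemma depth_le_depth_iterate_add (r : ℕ) (v : V) : T.depth v ≤ T.depth (T.parent^[r] v) + r := by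
  induction r with
  | zero => simp
  | succ r ih =>
    have := T.depth_le_depth_parent_add_one (T.parent^[r] v)
    rw [Function.iterate_succ_apply']
    omega

lemma exists_depth_eq {v : V} {k : ℕ} (h : k ≤ T.depth v) : ∃ w, T.depth w = k := by
  induction hd : T.depth v generalizing v with
  | zero => exact ⟨v, by omega⟩
  | succ d ih =>
    rcases h.eq_or_lt with h | h
    · exact ⟨v, h.symm⟩
    · have := T.depth_parent_of_depth_eq_succ hd
      exact ih (by omega) this

lemma card_desc_zero (w : V) : Nat.card (T.Desc 0 w) = 1 := by
  have : T.Desc 0 w = {w} := by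
    ext u
    simp only [Desc, Function.iterate_zero, id_eq, add_zero, Set.mem_ofPred_eq,
      Set.mem_singleton_iff]
    exact ⟨And.left, fun h => ⟨h, by rw [h]⟩⟩
  rw [this]
  simp

lemma dgf_nonneg {b : ℝ} (hb0 : 0 ≤ b) (v : V) : 0 ≤ T.dgf b v :=
  tsum_nonneg fun r => by positivity

lemma depth_lt_card [Fintype V] (v : V) : T.depth v < Fintype.card V := by
  classical
  have h : Finset.range (T.depth v + 1) ⊆ Finset.univ.image T.depth := fun k hk => by
    obtain ⟨w, hw⟩ := T.exists_depth_eq (Nat.lt_succ_iff.1 (Finset.mem_range.1 hk))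
    exact Finset.mem_image.2 ⟨w, Finset.mem_univ w, hw⟩
  simpa using (Finset.card_le_card h).trans Finset.card_image_le

/-- The coordinatewise Lipschitz constants left after averaging over all levels below `k`,
starting from the constant `s` in each coordinate. -/
noncomputable def levelWeight (b s : ℝ) (k : ℕ) (v : V) : ℝ :=
  if k < T.depth v then 0 else if T.depth v = k then s * T.dgf b v else s

lemma levelWeight_nonneg {b : ℝ} (hb0 : 0 ≤ b) {s : ℝ} (hs : 0 ≤ s) (k : ℕ) (v : V) :
    0 ≤ T.levelWeight b s k v := by
  have := T.dgf_nonneg hb0 v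
  unfold levelWeight
  split_ifs <;> positivity

end Depth

section GeneratingFunction

variable {V : Type*} [Fintype V] (T : ParentTree V)

lemma card_desc_succ [DecidableEq V] (r : ℕ) (w : V) :
    Nat.card (T.Desc (r + 1) w) =
      ∑ v with T.depth v = T.depth w + 1 ∧ T.parent v = w, Nat.card (T.Desc r v) := by
  have hcard : ∀ r v, Nat.card (T.Desc r v) =
      (Finset.univ.filter fun u => T.parent^[r] u = v ∧ T.depth u = T.depth v + r).card :=
    fun r v => by
      rw [← Fintype.card_subtype, ← Nat.card_eq_fintype_card]
      rfl
  simp only [hcard]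
  rw [Finset.card_eq_sum_card_fiberwise (f := T.parent^[r])
    (t := Finset.univ.filter fun v => T.depth v = T.depth w + 1 ∧ T.parent v = w)]
  · refine Finset.sum_congr rfl fun v hv => congrArg Finset.card ?_
    obtain ⟨hv₁, hv₂⟩ := (Finset.mem_filter.1 hv).2
    ext u
    simp only [Finset.mem_filter, Finset.mem_univ, true_and, Function.iterate_succ_apply']
    constructor
    · rintro ⟨⟨-, h⟩, rfl⟩
      exact ⟨rfl, by omega⟩
    · rintro ⟨rfl, h⟩
      exact ⟨⟨hv₂, by omega⟩, rfl⟩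
  · intro u hu
    simp only [Finset.coe_filter, Finset.mem_univ, true_and, Set.mem_ofPred_eq,
      Function.iterate_succ_apply'] at hu ⊢
    obtain ⟨hu₁, hu₂⟩ := hu
    have h₁ := T.depth_le_depth_iterate_add r u
    have h₂ := T.depth_le_depth_parent_add_one (T.parent^[r] u)
    rw [hu₁] at h₂
    exact ⟨by omega, hu₁⟩

variable {b : ℝ}

lemma summable_dgf (hb0 : 0 ≤ b) (hb1 : b < 1) (v : V) :
    Summable fun r : ℕ => (Nat.card (T.Desc r v) : ℝ) * b ^ r := by
  refine Summable.of_nonneg_of_le (fun r => by positivity) (fun r => ?_)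
    ((summable_geometric_of_lt_one hb0 hb1).mul_left (Fintype.card V : ℝ))
  refine mul_le_mul_of_nonneg_right ?_ (pow_nonneg hb0 r)
  rw [← Nat.card_eq_fintype_card]
  exact_mod_cast Nat.card_le_card_of_injective _ Subtype.val_injective

/-- The generating function of a vertex in terms of those of its children. -/
lemma dgf_eq_one_add [DecidableEq V] (hb0 : 0 ≤ b) (hb1 : b < 1) (w : V) :
    T.dgf b w = 1 + b * ∑ v with T.depth v = T.depth w + 1 ∧ T.parent v = w, T.dgf b v := by
  have hs := T.summable_dgf hb0 hb1
  rw [dgf, (hs w).tsum_eq_zero_add, T.card_desc_zero]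
  simp only [dgf]
  rw [← Summable.tsum_finsetSum fun v _ => hs v, ← tsum_mul_left]
  simp only [T.card_desc_succ, Nat.cast_sum, Finset.sum_mul, Finset.mul_sum]
  norm_num
  refine tsum_congr fun r => Finset.sum_congr rfl fun v _ => ?_
  ring

/-- Averaging over level `k + 1` turns the weights at `k + 1` into the weights at `k`. -/
lemma sum_levelWeight_succ (hb0 : 0 ≤ b) (hb1 : b < 1) (s : ℝ) (k : ℕ) (D : V → ℝ) :
    ∑ v, T.levelWeight b s (k + 1) v *
        (if T.depth v = k + 1 then b * D (T.parent v) else D v) =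
      ∑ v, T.levelWeight b s k v * D v := by
  classical
  have h₁ : ∀ v, T.levelWeight b s (k + 1) v *
        (if T.depth v = k + 1 then b * D (T.parent v) else D v) =
      (∑ w, if T.depth v = k + 1 ∧ T.parent v = w then s * b * T.dgf b v * D w else 0) +
        (if T.depth v ≤ k then s * D v else 0) := by
    intro v
    by_cases h : T.depth v = k + 1
    · simp only [levelWeight, h, lt_irrefl, if_true, if_false, true_and, Finset.sum_ite_eq,
        Finset.mem_univ, show ¬ k + 1 ≤ k by omega]
      ring
    · by_cases h' : T.depth v ≤ k
      · simp [levelWeight, h, h', show ¬ k + 1 < T.depth v by omega]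
      · simp [levelWeight, h, h', show k + 1 < T.depth v by omega]
  rw [Finset.sum_congr rfl fun v _ => h₁ v, Finset.sum_add_distrib, Finset.sum_comm,
    ← Finset.sum_add_distrib]
  refine Finset.sum_congr rfl fun w _ => ?_
  rw [← Finset.sum_filter]
  by_cases h : T.depth w = k
  · subst h
    simp only [levelWeight, lt_irrefl, if_true, if_false, le_refl]
    rw [T.dgf_eq_one_add hb0 hb1 w, ← Finset.sum_mul, ← Finset.mul_sum]
    ring
  · rw [Finset.filter_false_of_mem, Finset.sum_empty, zero_add]
    · by_cases h' : T.depth w ≤ k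
      · simp [levelWeight, h, h', show ¬ k < T.depth w by omega]
      · simp [levelWeight, h', show k < T.depth w by omega]
    · rintro v - ⟨hv, rfl⟩
      exact h (T.depth_parent_of_depth_eq_succ hv)

end GeneratingFunction

section LevelMeasure

variable {V : Type*} [Fintype V] (T : ParentTree V) {H : Type*} [MeasurableSpace H]

/-- The marginals of the transition from level `k` to level `k + 1`. -/
noncomputable def levelMarginal (q : V → Kernel H H) (k : ℕ) (x : V → H) (v : V) : Measure H :=
  if T.depth v = k + 1 then q v (x (T.parent v)) else Measure.dirac (x v)

instance (q : V → Kernel H H) [∀ v, IsMarkovKernel (q v)] (k : ℕ) (x : V → H) (v : V) :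
    IsProbabilityMeasure (T.levelMarginal q k x v) := by
  unfold levelMarginal
  split_ifs <;> infer_instance

lemma measurable_pi_levelMarginal (q : V → Kernel H H) [∀ v, IsMarkovKernel (q v)] (k : ℕ) :
    Measurable fun x : V → H => Measure.pi (T.levelMarginal q k x) := by
  refine measurable_measure_pi fun v => ?_
  unfold levelMarginal
  split_ifs
  · exact (q v).measurable.comp (measurable_pi_apply _)
  · exact Measure.measurable_dirac.comp (measurable_pi_apply v)

lemma levelMeasure_succ (m : Measure H) (q : V → Kernel H H) (k : ℕ) :
    T.levelMeasure m q (k + 1) =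
      (T.levelMeasure m q k).bind fun x => Measure.pi (T.levelMarginal q k x) :=
  rfl

lemma isProbabilityMeasure_levelMeasure (m : Measure H) [IsProbabilityMeasure m]
    (q : V → Kernel H H) [∀ v, IsMarkovKernel (q v)] (k : ℕ) :
    IsProbabilityMeasure (T.levelMeasure m q k) := by
  induction k with
  | zero => exact Measure.isProbabilityMeasure_map (by fun_prop)
  | succ k ih =>
    rw [levelMeasure_succ]
    exact isProbabilityMeasure_bind (T.measurable_pi_levelMarginal q k).aemeasurable
      (.of_forall fun x => inferInstance)

end LevelMeasure

section Concentration

variable {V : Type*} [Fintype V] (T : ParentTree V) {H : Type*} [PseudoMetricSpace H]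
  [MeasurableSpace H] [BorelSpace H] [SecondCountableTopology H] {b s : ℝ}

lemma coordLipschitz_integral_levelMarginal (hd : ∀ x y : H, dist x y ≤ 1) (hb0 : 0 ≤ b)
    (hb1 : b < 1) (hs : 0 ≤ s) (q : V → Kernel H H) [∀ v, IsMarkovKernel (q v)]
    (hq : ∀ v, v ≠ T.root → ∀ x y : H, transportCost dist (q v x) (q v y) ≤ b * dist x y)
    (k : ℕ) {F : (V → H) → ℝ} (hF : CoordLipschitz (T.levelWeight b s (k + 1)) F) :
    CoordLipschitz (T.levelWeight b s k) fun x => ∫ y, F y ∂Measure.pi (T.levelMarginal q k x) := by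
  intro x y
  rw [← T.sum_levelWeight_succ hb0 hb1]
  refine hF.abs_integral_pi_sub_le hd (T.levelWeight_nonneg hb0 hs _) _ _ fun v => ?_
  unfold levelMarginal
  split_ifs with h
  · exact hq v (T.ne_root_of_depth_eq_succ h) _ _
  · exact transportCost_dirac_le _ _

lemma integral_exp_levelMeasure_le (hd : ∀ x y : H, dist x y ≤ 1) (hb0 : 0 ≤ b) (hb1 : b < 1)
    (hs : 0 ≤ s) (m : Measure H) [IsProbabilityMeasure m] (q : V → Kernel H H)
    [∀ v, IsMarkovKernel (q v)]
    (hq : ∀ v, v ≠ T.root → ∀ x y : H, transportCost dist (q v x) (q v y) ≤ b * dist x y)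
    (k : ℕ) {F : (V → H) → ℝ} (hF : CoordLipschitz (T.levelWeight b s k) F) (t : ℝ) :
    ∫ x, Real.exp (t * F x) ∂T.levelMeasure m q k ≤
      Real.exp (t * ∫ x, F x ∂T.levelMeasure m q k +
        t ^ 2 / 8 * ∑ v with T.depth v ≤ k, (s * T.dgf b v) ^ 2) := by
  induction k generalizing F with
  | zero =>
    have hm : Measurable fun (h : H) (_ : V) => h := by fun_prop
    have hroot : ∀ v, T.depth v = 0 ↔ v = T.root := fun v =>
      ⟨T.eq_root_of_depth_eq_zero, fun h => h ▸ T.depth_root⟩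
    have hsum : ∑ v with T.depth v ≤ 0, (s * T.dgf b v) ^ 2 = (s * T.dgf b T.root) ^ 2 := by
      classical
      simp [hroot, Finset.sum_filter]
    rw [hsum, levelMeasure, integral_map hm.aemeasurable hF.measurable.aestronglyMeasurable,
      integral_map hm.aemeasurable
        (hF.measurable.const_mul t).exp.aestronglyMeasurable]
    refine integral_exp_le_of_abs_sub_le m (hF.measurable.comp hm) (fun h h' => ?_) t
    refine (hF _ _).trans ?_
    rw [Finset.sum_eq_single T.root (fun v _ hv => ?_) (fun h => absurd (Finset.mem_univ _) h)]
    · simp only [levelWeight, T.depth_root, lt_irrefl, if_true, if_false]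
      exact mul_le_of_le_one_right (mul_nonneg hs (T.dgf_nonneg hb0 _)) (hd _ _)
    · have : T.depth v ≠ 0 := fun h => hv ((hroot v).1 h)
      simp [levelWeight, Nat.pos_of_ne_zero this]
  | succ k ih =>
    have := T.isProbabilityMeasure_levelMeasure m q k
    have := T.isProbabilityMeasure_levelMeasure m q (k + 1)
    have hκ := T.measurable_pi_levelMarginal q k
    have hE := hF.integrable_exp hd t (T.levelMeasure m q (k + 1))
    have hI := hF.integrable hd (T.levelMeasure m q (k + 1))
    have hG := T.coordLipschitz_integral_levelMarginal hd hb0 hb1 hs q hq k hF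
    have key := ih hG
    rw [levelMeasure_succ] at hE hI ⊢
    rw [← integral_bind_of_measurable hκ hI] at key
    rw [integral_bind_of_measurable hκ hE]
    have hstep : ∀ x, ∫ y, Real.exp (t * F y) ∂Measure.pi (T.levelMarginal q k x) ≤
        Real.exp (t * ∫ y, F y ∂Measure.pi (T.levelMarginal q k x)) *
          Real.exp (t ^ 2 / 8 * ∑ v with T.depth v = k + 1, (s * T.dgf b v) ^ 2) := fun x => by
      rw [← Real.exp_add]
      refine (hF.integral_exp_pi_le hd (T.levelWeight_nonneg hb0 hs _)
        (Finset.univ.filter fun v => T.depth v = k + 1) x _ (fun v hv => ?_) t).trans_eq ?_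
      · exact if_neg (by simpa using hv)
      · congr 3
        refine Finset.sum_congr rfl fun v hv => ?_
        simp [levelWeight, (Finset.mem_filter.1 hv).2]
    refine (integral_mono (integrable_integral_of_bind hκ hE)
      ((hG.integrable_exp hd t _).mul_const _) hstep).trans ?_
    rw [integral_mul_const]
    refine (mul_le_mul_of_nonneg_right key (Real.exp_nonneg _)).trans_eq ?_
    have hsplit : ∑ v with T.depth v ≤ k + 1, (s * T.dgf b v) ^ 2 =
        ∑ v with T.depth v ≤ k, (s * T.dgf b v) ^ 2 +
          ∑ v with T.depth v = k + 1, (s * T.dgf b v) ^ 2 := by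
      simp only [Finset.sum_filter]
      rw [← Finset.sum_add_distrib]
      refine Finset.sum_congr rfl fun v _ => ?_
      split_ifs <;> first | omega | simp
    rw [← Real.exp_add, hsplit]
    ring_nf

/-- A Lipschitz function of a Lipschitz Markov measure is sub-Gaussian. -/
lemma hasSubgaussianMGF_of_isLipMarkov (hd : ∀ x y : H, dist x y ≤ 1) (hb0 : 0 ≤ b) (hb1 : b < 1)
    {ν : Measure (V → H)} (hν : T.IsLipMarkov b ν) {f : (V → H) → ℝ}
    (hf : ∀ x y : V → H, |f x - f y| ≤ nhdist x y) :
    HasSubgaussianMGF (fun x => f x - ∫ y, f y ∂ν)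
      (((Fintype.card V : ℝ)⁻¹ * T.Delta b / 2) ^ 2).toNNReal ν := by
  obtain ⟨m, q, hm, hqm, hq, rfl⟩ := hν
  have := T.isProbabilityMeasure_levelMeasure m q (Fintype.card V)
  have hs : (0 : ℝ) ≤ (Fintype.card V : ℝ)⁻¹ := by positivity
  have hF : CoordLipschitz (T.levelWeight b (Fintype.card V : ℝ)⁻¹ (Fintype.card V)) f := by
    intro x y
    refine (hf x y).trans_eq ?_
    rw [nhdist, Finset.mul_sum]
    refine Finset.sum_congr rfl fun v _ => ?_
    have := T.depth_lt_card v
    rw [levelWeight, if_neg (by omega), if_neg (by omega)]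
  have hexp : ∀ c t x, Real.exp (t * (f x - c)) = Real.exp (t * f x) * Real.exp (-(t * c)) :=
      fun c t x => by
    rw [← Real.exp_add]
    ring_nf
  refine ⟨fun t => ?_, fun t => ?_⟩
  · simp only [hexp]
    exact (hF.integrable_exp hd t _).mul_const _
  · simp only [mgf, hexp]
    rw [integral_mul_const]
    refine (mul_le_mul_of_nonneg_right
      (T.integral_exp_levelMeasure_le hd hb0 hb1 hs m q hq _ hF t) (Real.exp_nonneg _)).trans_eq ?_
    rw [← Real.exp_add, Real.coe_toNNReal _ (sq_nonneg _), Finset.filter_true_of_mem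
      fun v _ => (T.depth_lt_card v).le, div_pow, mul_pow, Delta,
      Real.sq_sqrt (Finset.sum_nonneg fun v _ => sq_nonneg _)]
    simp only [mul_pow]
    rw [← Finset.mul_sum]
    ring_nf

end Concentration

end ParentTree

/-- **Theorem (concentration of Lipschitz functions).** Let `T` be a finite rooted tree
with `n` vertices, `H` a Polish metric space of diameter at most `1`, `b ∈ [0,1)`, and
`ν` a `b`-Lipschitz `H`-valued Markov measure indexed by `T`. Then for every `f` which
is 1-Lipschitz for the normalized Hamming metric and every `ε > 0`,
`ν{|f − ∫ f dν| > ε} ≤ 2·exp(−2n²ε²/Δ²)`. -/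
theorem markov_tail_bound
    {V : Type} [Fintype V] (T : ParentTree V)
    {H : Type} [MetricSpace H] [TopologicalSpace.SeparableSpace H] [CompleteSpace H]
    [MeasurableSpace H] [BorelSpace H]
    (hdiam : EMetric.diam (Set.univ : Set H) ≤ 1)
    {b : ℝ} (hb0 : 0 ≤ b) (hb1 : b < 1)
    (ν : MeasureTheory.Measure (V → H)) (hν : T.IsLipMarkov b ν)
    (f : (V → H) → ℝ) (hf : ∀ x y : V → H, |f x - f y| ≤ nhdist x y)
    (ε : ℝ) (hε : 0 < ε) :
    ν {x | ε < |f x - ∫ y, f y ∂ν|} ≤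
      ENNReal.ofReal (2 * Real.exp (-2 * (Fintype.card V : ℝ) ^ 2 * ε ^ 2 / (T.Delta b) ^ 2)) := by
  have : SecondCountableTopology H := UniformSpace.secondCountable_of_separable H
  have hd : ∀ x y : H, dist x y ≤ 1 := fun x y => by
    have := (Metric.edist_le_ediam_of_mem (Set.mem_univ x) (Set.mem_univ y)).trans hdiam
    rwa [edist_dist, ENNReal.ofReal_le_one] at this
  have hsub := T.hasSubgaussianMGF_of_isLipMarkov hd hb0 hb1 hν hf
  have : IsProbabilityMeasure ν := by
    obtain ⟨m, q, hm, hqm, -, rfl⟩ := hν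
    exact T.isProbabilityMeasure_levelMeasure m q _
  have hexp : Real.exp (-2 * (Fintype.card V : ℝ) ^ 2 * ε ^ 2 / (T.Delta b) ^ 2) =
      Real.exp (-ε ^ 2 / (2 * ((((Fintype.card V : ℝ)⁻¹ * T.Delta b / 2) ^ 2).toNNReal : ℝ))) := by
    rw [Real.coe_toNNReal _ (sq_nonneg _)]
    congr 1
    simp only [div_eq_mul_inv, mul_pow, mul_inv, inv_pow, inv_inv]
    ring
  have hsubset : {x | ε < |f x - ∫ y, f y ∂ν|} ⊆
      {x | ε ≤ f x - ∫ y, f y ∂ν} ∪ {x | ε ≤ (-fun x => f x - ∫ y, f y ∂ν) x} := fun x hx => by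
    simpa using le_abs.1 (le_of_lt (Set.mem_ofPred_eq ▸ hx :))
  rw [hexp, ← ofReal_measureReal]
  refine ENNReal.ofReal_le_ofReal ((measureReal_mono hsubset).trans
    ((measureReal_union_le _ _).trans ?_))
  rw [two_mul]
  exact add_le_add (hsub.measure_ge_le hε.le) (hsub.neg.measure_ge_le hε.le)
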